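/- Let d ≥ 2, let p_1,…,p_d ∈ ℝ^d, let P be the d×d matrix whose i-th column is p_i, and let S ⊂ ℝ^d be the convex hull of {0, p_1,…,p_d}. With t_d := 0, T_1 := 1, T_j := t_1⋯t_{j−1} for j ≥ 2, define η(t_1,…,t_{d−1}) := ∑_{j=1}^d T_j(1−t_j) p_j and ψ(t_1,…,t_{d−1}) := ∏_{i=1}^{d−2} t_i^{d−1−i}. Then for every continuous g : ℝ^d → ℝ, ∫_S g(x) dx = |det P| ∫_0^1 ∫_{(0,1)^{d−1}} g(r·η(t)) ψ(t) r^{d−1} dt dr, where the left-hand side is the Lebesgue integral over S. -/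

import Mathlib

open MeasureTheory

/-- Stick-breaking barycentric coefficients `T_j (1 - t_j)` (0-based indices). -/
noncomputable def stickCoeff (d : ℕ) (t : Fin (d - 1) → ℝ) (j : Fin d) : ℝ :=
  (∏ k ∈ Finset.univ.filter (fun k : Fin (d - 1) => (k : ℕ) < (j : ℕ)), t k) *
    (1 - if h : (j : ℕ) < d - 1 then t ⟨j, h⟩ else 0)

/-- The repeated-linear-interpolation parametrization `η(t) = ∑ j T_j (1-t_j) p_j`. -/
noncomputable def etaMap {d : ℕ} {E : Type*} [AddCommGroup E] [Module ℝ E]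
    (p : Fin d → E) (t : Fin (d - 1) → ℝ) : E :=
  ∑ j : Fin d, stickCoeff d t j • p j

/-- The density factor `ψ(t) = ∏_{i=1}^{d-2} t_i^{d-1-i}` (0-based indices). -/
noncomputable def psiMap (d : ℕ) (t : Fin (d - 1) → ℝ) : ℝ :=
  ∏ k : Fin (d - 1), t k ^ (d - 2 - (k : ℕ))

/-- The corner simplex `{x ≥ 0, ∑ x ≤ 1}`. -/
def cornerSimplex (ι : Type*) [Fintype ι] : Set (ι → ℝ) :=
  {x | (∀ i, 0 ≤ x i) ∧ ∑ i, x i ≤ 1}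

/-- The open corner simplex `{x > 0, ∑ x < 1}`. -/
def openCornerSimplex (ι : Type*) [Fintype ι] : Set (ι → ℝ) :=
  {x | (∀ i, 0 < x i) ∧ ∑ i, x i < 1}

section Simplex

variable {ι : Type*} [Fintype ι]

theorem measurableSet_cornerSimplex : MeasurableSet (cornerSimplex ι) := by
  have : IsClosed (cornerSimplex ι) := by
    refine IsClosed.inter (s₁ := {x : ι → ℝ | ∀ i, 0 ≤ x i}) (s₂ := {x | ∑ i, x i ≤ 1}) ?_ ?_
    · simp only [Set.ofPred_forall]
      exact isClosed_iInter fun i => isClosed_le (by fun_prop) (by fun_prop)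
    · exact isClosed_le (by fun_prop) (by fun_prop)
  exact this.measurableSet

theorem convexHull_insert_zero_range {E : Type*} [AddCommGroup E] [Module ℝ E] (p : ι → E) :
    convexHull ℝ (insert 0 (Set.range p)) =
      (fun x : ι → ℝ => ∑ i, x i • p i) '' cornerSimplex ι := by
  classical
  apply subset_antisymm
  · refine convexHull_min ?_ ?_
    · rintro _ (rfl | ⟨i, rfl⟩)
      · exact ⟨0, ⟨by simp, by simp⟩, by simp⟩
      · refine ⟨Pi.single i 1, ⟨fun j => ?_, by simp⟩, by simp [Pi.single_apply]⟩
        by_cases h : j = i <;> simp [h]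
    · rintro _ ⟨x, ⟨hx, hx'⟩, rfl⟩ _ ⟨y, ⟨hy, hy'⟩, rfl⟩ a b ha hb hab
      refine ⟨a • x + b • y, ⟨fun i => ?_, ?_⟩, ?_⟩
      · have := mul_nonneg ha (hx i)
        have := mul_nonneg hb (hy i)
        simp only [Pi.add_apply, Pi.smul_apply, smul_eq_mul]
        linarith
      · simp only [Pi.add_apply, Pi.smul_apply, smul_eq_mul, Finset.sum_add_distrib,
          ← Finset.mul_sum]
        nlinarith
      · simp [add_smul, mul_smul, Finset.sum_add_distrib, Finset.smul_sum]
  · rintro _ ⟨x, ⟨hx, hx'⟩, rfl⟩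
    have := (convex_convexHull ℝ (insert 0 (Set.range p))).sum_mem (t := Finset.univ)
      (w := fun o : Option ι => o.elim (1 - ∑ i, x i) x) (z := fun o => o.elim 0 p)
      ?_ ?_ ?_
    · simpa using this
    · rintro (_ | i) -
      · simpa using hx'
      · exact hx i
    · simp
    · rintro (_ | i) - <;> apply subset_convexHull
      · simp
      · exact Or.inr ⟨i, rfl⟩

theorem openCornerSimplex_ae_eq_cornerSimplex [Nonempty ι] :
    (openCornerSimplex ι : Set (ι → ℝ)) =ᵐ[volume] cornerSimplex ι := by
  have hne : ∀ (f : (ι → ℝ) →ₗ[ℝ] ℝ) (c : ℝ), f ≠ 0 → ∀ᵐ x, f x ≠ c := by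
    intro f c hf
    obtain ⟨v, hv⟩ : ∃ v, f v ≠ 0 := by
      by_contra! h
      exact hf (LinearMap.ext h)
    have hnt : (AffineSubspace.mk' ((c / f v) • v) (LinearMap.ker f)) ≠ ⊤ := by
      intro h
      have h1 : ((c / f v) • v + v) ∈ (AffineSubspace.mk' ((c / f v) • v) (LinearMap.ker f)) := by
        rw [h]; trivial
      simp [AffineSubspace.mem_mk'] at h1
      exact hv h1
    have := Measure.addHaar_affineSubspace volume _ hnt
    rw [ae_iff]
    convert this using 2
    ext x
    simp [AffineSubspace.mem_mk', hv, sub_eq_zero]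
  have h1 : ∀ᵐ x : ι → ℝ, ∀ i, x i ≠ 0 := by
    classical
    rw [ae_all_iff]
    intro i
    refine hne (LinearMap.proj i) 0 fun h => ?_
    simpa using LinearMap.congr_fun h (Pi.single i 1)
  have h2 : ∀ᵐ x : ι → ℝ, ∑ i, x i ≠ 1 := by
    have := hne (∑ i, LinearMap.proj i) 1 fun h => ?_
    · simpa using this
    · simpa using LinearMap.congr_fun h 1
  filter_upwards [h1, h2] with x hx hx'
  refine propext ⟨fun h => ⟨fun i => (h.1 i).le, h.2.le⟩, fun h => ⟨fun i => ?_, ?_⟩⟩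
  · exact lt_of_le_of_ne (h.1 i) (hx i).symm
  · exact lt_of_le_of_ne h.2 hx'

theorem setIntegral_convexHull_insert_zero_range [DecidableEq ι] (p : ι → ι → ℝ)
    (g : (ι → ℝ) → ℝ) :
    ∫ x in convexHull ℝ (insert 0 (Set.range p)), g x =
      |(Matrix.of fun i j => p j i).det| * ∫ x in cornerSimplex ι, g (∑ i, x i • p i) := by
  set P : Matrix ι ι ℝ := Matrix.of fun i j => p j i
  set L : (ι → ℝ) →L[ℝ] (ι → ℝ) := LinearMap.toContinuousLinearMap (Matrix.toLin' P) with hL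
  have hLx : (fun x : ι → ℝ => ∑ i, x i • p i) = L := by
    ext x i
    simp [L, P, Matrix.mulVec, dotProduct, mul_comm]
  have hdet : L.det = P.det := by
    simp [L, ContinuousLinearMap.det]
  rw [convexHull_insert_zero_range, hLx]
  by_cases h0 : P.det = 0
  · have hr : LinearMap.range (Matrix.toLin' P) ≠ ⊤ := by
      intro h
      have := ((LinearMap.isUnit_iff_range_eq_top _).2 h).map LinearMap.det
      simp [h0] at this
    have hz : volume (L '' cornerSimplex ι) = 0 := by
      refine measure_mono_null ?_ (Measure.addHaar_submodule volume _ hr)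
      rintro _ ⟨x, -, rfl⟩
      exact ⟨x, rfl⟩
    rw [Measure.restrict_eq_zero.2 hz]
    simp [h0]
  · have hinj : Function.Injective L := by
      have := Matrix.mulVec_injective_iff_isUnit.2 ((Matrix.isUnit_iff_isUnit_det P).2 (Ne.isUnit h0))
      exact this
    rw [integral_image_eq_integral_abs_det_fderiv_smul volume measurableSet_cornerSimplex
      (fun x _ => L.hasFDerivAt.hasFDerivWithinAt) hinj.injOn]
    simp only [hdet, smul_eq_mul, integral_const_mul]
    simp [← hLx]

end Simplex

section StickBreaking

variable {n : ℕ}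

/-- The open unit cube in `ℝⁿ`. -/
local notation "cube" n => Set.univ.pi fun _ : Fin n => Set.Ioo (0 : ℝ) 1

/-- The difference operator `y ↦ (y_j - y_{j+1})_j`, with `y_{n+1} := 0`. -/
def backwardDiff (n : ℕ) : (Fin (n + 1) → ℝ) →ₗ[ℝ] (Fin (n + 1) → ℝ) where
  toFun y := y - Fin.snoc (α := fun _ => ℝ) (fun i : Fin n => y i.succ) 0
  map_add' y z := by
    ext j
    induction j using Fin.lastCases <;> simp; ring
  map_smul' c y := by
    ext j
    induction j using Fin.lastCases <;> simp; ring

theorem backwardDiff_last (y : Fin (n + 1) → ℝ) :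
    backwardDiff n y (Fin.last n) = y (Fin.last n) := by
  simp [backwardDiff]

theorem backwardDiff_castSucc (y : Fin (n + 1) → ℝ) (i : Fin n) :
    backwardDiff n y i.castSucc = y i.castSucc - y i.succ := by
  simp [backwardDiff]

theorem sum_backwardDiff (y : Fin (n + 1) → ℝ) : ∑ j, backwardDiff n y j = y 0 := by
  rw [Fin.sum_univ_castSucc]
  simp only [backwardDiff_last, backwardDiff_castSucc, Finset.sum_sub_distrib]
  have h1 := Fin.sum_univ_castSucc y
  have h2 := Fin.sum_univ_succ y
  linarith

theorem backwardDiff_suffixSum (x : Fin (n + 1) → ℝ) :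
    backwardDiff n (fun j => ∑ i ∈ Finset.Ici j, x i) = x := by
  ext j
  induction j using Fin.lastCases with
  | last =>
    rw [backwardDiff_last]
    simp [← Fin.top_eq_last]
  | cast i =>
    have : Finset.Ici i.castSucc = insert i.castSucc (Finset.Ici i.succ) := by
      ext k
      simp only [Finset.mem_Ici, Finset.mem_insert, Fin.le_def, Fin.ext_iff, Fin.val_castSucc,
        Fin.val_succ]
      omega
    rw [backwardDiff_castSucc, this, Finset.sum_insert (by simp [Fin.le_def])]
    ring

theorem det_backwardDiff : LinearMap.det (backwardDiff n) = 1 := by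
  rw [← LinearMap.det_toMatrix', Matrix.det_of_isUpperTriangular]
  · refine Finset.prod_eq_one fun j _ => ?_
    induction j using Fin.lastCases with
    | last => simp [LinearMap.toMatrix'_apply, backwardDiff_last]
    | cast i => simp [LinearMap.toMatrix'_apply, backwardDiff_castSucc, Fin.ext_iff]
  · intro j k hjk
    simp only [id] at hjk
    induction j using Fin.lastCases with
    | last => simp [LinearMap.toMatrix'_apply, backwardDiff_last, hjk.ne']
    | cast i =>
      have : i.succ ≠ k := (hjk.trans i.castSucc_lt_succ).ne'
      simp [LinearMap.toMatrix'_apply, backwardDiff_castSucc, hjk.ne', this]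

theorem injective_backwardDiff : Function.Injective (backwardDiff n) := by
  have : IsUnit (backwardDiff n) := by
    rw [LinearMap.isUnit_iff_isUnit_det, det_backwardDiff]
    exact isUnit_one
  exact ((Module.End.isUnit_iff _).1 this).1

/-- The partial products `u ↦ (u_0 ⋯ u_j)_j`. -/
def partialProd (u : Fin n → ℝ) (j : Fin n) : ℝ := ∏ k ∈ Finset.Iic j, u k

theorem partialProd_zero (u : Fin (n + 1) → ℝ) : partialProd u 0 = u 0 := by
  simp [partialProd, ← bot_eq_zero]

theorem partialProd_succ (u : Fin (n + 1) → ℝ) (i : Fin n) :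
    partialProd u i.succ = u i.succ * partialProd u i.castSucc := by
  have : Finset.Iic i.succ = insert i.succ (Finset.Iic i.castSucc) := by
    ext k
    simp only [Finset.mem_Iic, Finset.mem_insert, Fin.le_def, Fin.ext_iff, Fin.val_castSucc,
      Fin.val_succ]
    omega
  rw [partialProd, this, Finset.prod_insert (by simp [Fin.le_def]), partialProd]

theorem partialProd_pos {u : Fin n → ℝ} (hu : u ∈ cube n) (j : Fin n) : 0 < partialProd u j :=
  Finset.prod_pos fun k _ => (hu k trivial).1

theorem injOn_partialProd : Set.InjOn (partialProd (n := n + 1)) (cube (n + 1)) := by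
  intro u hu v hv huv
  ext j
  induction j using Fin.cases with
  | zero => rw [← partialProd_zero u, huv, partialProd_zero]
  | succ i =>
    have h := congrFun huv i.succ
    rw [partialProd_succ, partialProd_succ, huv] at h
    exact mul_right_cancel₀ (ne_of_gt (partialProd_pos hv _)) h

/-- The derivative of `partialProd` at `u`. -/
noncomputable def partialProdDeriv (u : Fin n → ℝ) : (Fin n → ℝ) →L[ℝ] (Fin n → ℝ) :=
  ContinuousLinearMap.pi fun j =>
    ∑ i ∈ Finset.Iic j, (∏ k ∈ (Finset.Iic j).erase i, u k) • ContinuousLinearMap.proj i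

theorem hasFDerivAt_partialProd (u : Fin n → ℝ) :
    HasFDerivAt partialProd (partialProdDeriv u) u := by
  refine hasFDerivAt_pi.2 fun j => ?_
  exact HasFDerivAt.finsetProd fun i _ => hasFDerivAt_apply i u

theorem det_partialProdDeriv (u : Fin n → ℝ) :
    LinearMap.det (partialProdDeriv u : (Fin n → ℝ) →ₗ[ℝ] (Fin n → ℝ)) =
      ∏ k, u k ^ (n - 1 - (k : ℕ)) := by
  have hentry : ∀ j i, LinearMap.toMatrix' (partialProdDeriv u : (Fin n → ℝ) →ₗ[ℝ] _) j i =
      if i ≤ j then ∏ k ∈ (Finset.Iic j).erase i, u k else 0 := by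
    intro j i
    simp [LinearMap.toMatrix'_apply, partialProdDeriv, Pi.single_apply]
  rw [← LinearMap.det_toMatrix', Matrix.det_of_isLowerTriangular]
  · simp only [hentry, le_refl, if_true, Finset.Iic_erase]
    rw [Finset.prod_comm' (t' := Finset.univ) (s' := fun k => Finset.Ioi k) (by simp)]
    simp
  · intro j i hji
    rw [hentry, if_neg (not_le.2 (by simpa using hji))]

/-- Stick breaking: `u ↦ (u_0 ⋯ u_j (1 - u_{j+1}))_j`, with `u_{n+1} := 0`. -/
def stickBreaking (u : Fin (n + 1) → ℝ) : Fin (n + 1) → ℝ := backwardDiff n (partialProd u)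

theorem injOn_stickBreaking : Set.InjOn (stickBreaking (n := n)) (cube (n + 1)) :=
  injective_backwardDiff.comp_injOn injOn_partialProd

theorem stickBreaking_image_cube :
    stickBreaking '' (cube (n + 1)) = openCornerSimplex (Fin (n + 1)) := by
  apply subset_antisymm
  · rintro _ ⟨u, hu, rfl⟩
    refine ⟨fun j => ?_, ?_⟩
    · induction j using Fin.lastCases with
      | last => rw [stickBreaking, backwardDiff_last]; exact partialProd_pos hu _
      | cast i =>
        rw [stickBreaking, backwardDiff_castSucc, partialProd_succ]
        nlinarith [partialProd_pos hu i.castSucc, (hu i.succ trivial).2]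
    · simp only [stickBreaking]
      rw [sum_backwardDiff, partialProd_zero]
      exact (hu 0 trivial).2
  · rintro x ⟨hx, hx'⟩
    set y : Fin (n + 1) → ℝ := fun j => ∑ i ∈ Finset.Ici j, x i with hy
    have hdiff : backwardDiff n y = x := backwardDiff_suffixSum x
    have hpos : ∀ j, 0 < y j := fun j =>
      Finset.sum_pos (fun i _ => hx i) ⟨j, Finset.mem_Ici.2 le_rfl⟩
    have hlt : ∀ i : Fin n, y i.succ < y i.castSucc := fun i => by
      have := backwardDiff_castSucc y i
      rw [hdiff] at this
      linarith [hx i.castSucc]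
    set u : Fin (n + 1) → ℝ := Fin.cons (y 0) fun i : Fin n => y i.succ / y i.castSucc with hu
    have hprod : partialProd u = y := by
      ext j
      induction j using Fin.induction with
      | zero => simp [partialProd_zero, hu]
      | succ i ih =>
        rw [partialProd_succ, ih, hu, Fin.cons_succ, div_mul_cancel₀ _ (hpos _).ne']
    refine ⟨u, fun j _ => ?_, by rw [stickBreaking, hprod, hdiff]⟩
    induction j using Fin.cases with
    | zero =>
      refine ⟨hpos 0, ?_⟩
      change y 0 < 1
      rw [← sum_backwardDiff y, hdiff]
      exact hx'
    | succ i => exact ⟨div_pos (hpos _) (hpos _), (div_lt_one (hpos _)).2 (hlt i)⟩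

theorem continuous_stickBreaking : Continuous (stickBreaking (n := n)) := by
  have h : Continuous (partialProd (n := n + 1)) :=
    continuous_pi fun j => continuous_finsetProd _ fun k _ => continuous_apply k
  exact (backwardDiff n).continuous_of_finiteDimensional.comp h

theorem setIntegral_cornerSimplex_eq_cube (h : (Fin (n + 1) → ℝ) → ℝ) :
    ∫ x in cornerSimplex (Fin (n + 1)), h x =
      ∫ u in cube (n + 1), (∏ k, u k ^ (n - (k : ℕ))) * h (stickBreaking u) := by
  have hm : MeasurableSet (cube (n + 1)) := MeasurableSet.univ_pi fun _ => measurableSet_Ioo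
  set L := LinearMap.toContinuousLinearMap (backwardDiff n)
  rw [← setIntegral_congr_set openCornerSimplex_ae_eq_cornerSimplex, ← stickBreaking_image_cube,
    integral_image_eq_integral_abs_det_fderiv_smul volume hm (f := stickBreaking)
      (f' := fun u => L ∘L partialProdDeriv u)
      (fun u _ => (L.hasFDerivAt.comp u (hasFDerivAt_partialProd u)).hasFDerivWithinAt)
      injOn_stickBreaking]
  refine setIntegral_congr_fun hm fun u hu => ?_
  have hdet : (L ∘L partialProdDeriv u).det = ∏ k, u k ^ (n - (k : ℕ)) := by
    have := det_partialProdDeriv u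
    rw [ContinuousLinearMap.det, ContinuousLinearMap.toLinearMap_comp, LinearMap.det_comp, this]
    simp [L, det_backwardDiff]
  simp only [hdet, smul_eq_mul]
  rw [abs_of_nonneg (Finset.prod_nonneg fun k _ => pow_nonneg (hu k trivial).1.le _)]

theorem setIntegral_cube_succ {f : (Fin (n + 1) → ℝ) → ℝ} (hf : Continuous f) :
    ∫ u in cube (n + 1), f u =
      ∫ r in Set.Ioo (0 : ℝ) 1, ∫ t in cube n, f (Fin.cons r t) := by
  set e := (MeasurableEquiv.piFinSuccAbove (fun _ : Fin (n + 1) => ℝ) 0).symm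
  have he : MeasurePreserving e :=
    (volume_preserving_piFinSuccAbove (fun _ : Fin (n + 1) => ℝ) 0).symm _
  have hcons : ∀ z, e z = Fin.cons z.1 z.2 := fun z => by
    simp [e, MeasurableEquiv.piFinSuccAbove_symm_apply, Fin.insertNthEquiv]
  have hpre : e ⁻¹' (cube (n + 1)) = Set.Ioo (0 : ℝ) 1 ×ˢ cube n := by
    ext z
    simp [hcons, Fin.forall_fin_succ, Set.mem_pi]
  rw [← he.setIntegral_preimage_emb e.measurableEmbedding, hpre]
  simp only [hcons]
  rw [Measure.volume_eq_prod, setIntegral_prod]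
  have hc : Continuous fun z : ℝ × (Fin n → ℝ) =>
      f (Fin.cons (α := fun _ => ℝ) z.1 z.2) := by
    refine hf.comp (continuous_pi fun j => ?_)
    induction j using Fin.cases <;> simp <;> fun_prop
  have hK : IsCompact (Set.Icc (0 : ℝ) 1 ×ˢ Set.univ.pi fun _ : Fin n => Set.Icc (0 : ℝ) 1) :=
    isCompact_Icc.prod (isCompact_univ_pi fun _ => isCompact_Icc)
  rw [← Measure.volume_eq_prod]
  refine (hc.continuousOn.integrableOn_compact hK).mono_set (Set.prod_mono ?_ ?_)
  · exact Set.Ioo_subset_Icc_self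
  · exact Set.pi_mono fun _ _ => Set.Ioo_subset_Icc_self

theorem partialProd_cons (r : ℝ) (t : Fin n → ℝ) (j : Fin (n + 1)) :
    partialProd (Fin.cons r t : Fin (n + 1) → ℝ) j =
      r * ∏ k ∈ Finset.univ.filter (fun k : Fin n => (k : ℕ) < (j : ℕ)), t k := by
  have : Finset.Iic j = Finset.univ.filter (· ≤ j) := by ext; simp
  rw [partialProd, this, Finset.prod_filter, Fin.prod_univ_succ, Finset.prod_filter]
  simp [Fin.le_def]

theorem stickBreaking_cons (r : ℝ) (t : Fin n → ℝ) (j : Fin (n + 1)) :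
    stickBreaking (Fin.cons r t : Fin (n + 1) → ℝ) j = r * stickCoeff (n + 1) t j := by
  induction j using Fin.lastCases with
  | last => simp [stickBreaking, backwardDiff_last, partialProd_cons, stickCoeff]
  | cast i =>
    rw [stickBreaking, backwardDiff_castSucc, partialProd_succ, Fin.cons_succ, partialProd_cons]
    simp [stickCoeff]
    ring

end StickBreaking

/-- for the simplex `S = conv{0, p_1, …, p_d}` and continuous `g`,
`∫_S g = |det P| ∫_0^1 ∫_{(0,1)^{d-1}} g(r·η(t)) ψ(t) r^{d-1} dt dr`. -/
theorem integral_simplex_eq_param (d : ℕ) (hd : 2 ≤ d)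
    (p : Fin d → (Fin d → ℝ)) (g : (Fin d → ℝ) → ℝ) (hg : Continuous g) :
    ∫ x in convexHull ℝ (insert (0 : Fin d → ℝ) (Set.range p)), g x
    = |Matrix.det (Matrix.of fun i j => p j i)| *
      ∫ r in Set.Ioo (0 : ℝ) 1,
        ∫ t in (Set.univ.pi fun _ : Fin (d - 1) => Set.Ioo (0 : ℝ) 1),
          g (r • etaMap p t) * psiMap d t * r ^ (d - 1) := by
  obtain ⟨n, rfl⟩ : ∃ n, d = n + 1 := ⟨d - 1, by omega⟩
  have hcont : Continuous fun u : Fin (n + 1) → ℝ =>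
      (∏ k, u k ^ (n - (k : ℕ))) * g (∑ i, stickBreaking u i • p i) := by
    have := continuous_stickBreaking (n := n)
    fun_prop
  rw [setIntegral_convexHull_insert_zero_range, setIntegral_cornerSimplex_eq_cube,
    setIntegral_cube_succ hcont]
  congr 1
  refine integral_congr_ae (Filter.Eventually.of_forall fun r => ?_)
  refine integral_congr_ae (Filter.Eventually.of_forall fun t => ?_)
  have heta : ∑ i, stickBreaking (Fin.cons r t : Fin (n + 1) → ℝ) i • p i = r • etaMap p t := by
    simp only [stickBreaking_cons, etaMap, Finset.smul_sum, mul_smul]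
  have hpsi : ∏ k, (Fin.cons r t : Fin (n + 1) → ℝ) k ^ (n - (k : ℕ)) =
      r ^ n * psiMap (n + 1) t := by
    rw [Fin.prod_univ_succ, psiMap]
    simp only [Fin.cons_zero, Fin.cons_succ, Fin.val_zero, Fin.val_succ, Nat.sub_zero]
    congr 1
    exact Finset.prod_congr rfl fun k _ => by congr 1; omega
  change _ * g _ = g (r • etaMap p t) * psiMap (n + 1) t * r ^ n
  rw [heta, hpsi]
  ring
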